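/- arXiv:math/0405580 — 3 statements merged into one kernel-verified Lean document; each statement's English description precedes it below -/
import Mathlib

section
/- The subgroup of SL₂(ℂ) generated by σ₄, τ and μ (the binary tetrahedral group) is a finite group of order 24. -/
noncomputable section

open Complex Matrix MvPolynomial

/-- `SL₂(ℂ)`. -/
abbrev SL2 : Type := Matrix.SpecialLinearGroup (Fin 2) ℂ

/-- `ω N = exp(2πi/N)`. -/
def ω (N : ℕ) : ℂ := Complex.exp (2 * Real.pi * Complex.I / N)

/-- `σ N = [[ω_N, 0],[0, ω_N⁻¹]] ∈ SL₂(ℂ)`. -/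
def σ (N : ℕ) : SL2 :=
  ⟨!![ω N, 0; 0, (ω N)⁻¹], by
    have h : ω N ≠ 0 := Complex.exp_ne_zero _
    simp [Matrix.det_fin_two_of, mul_inv_cancel₀ h]⟩

/-- `τ = [[0,1],[−1,0]] ∈ SL₂(ℂ)`. -/
def τ : SL2 :=
  ⟨!![0, 1; -1, 0], by simp [Matrix.det_fin_two_of]⟩

lemma ω_eight_pow_eight : ω 8 ^ 8 = 1 := by
  rw [ω, ← Complex.exp_nat_mul]
  rw [show ((8 : ℕ) : ℂ) * (2 * Real.pi * Complex.I / ((8:ℕ) : ℂ)) = 2 * Real.pi * Complex.I by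
    push_cast; ring]
  exact Complex.exp_two_pi_mul_I

lemma ω_eight_pow_four : ω 8 ^ 4 = -1 := by
  rw [ω, ← Complex.exp_nat_mul]
  rw [show ((4 : ℕ) : ℂ) * (2 * Real.pi * Complex.I / ((8:ℕ) : ℂ)) = Real.pi * Complex.I by
    push_cast; ring]
  exact Complex.exp_pi_mul_I

/-- `μ = (1/√2)·[[ω₈⁷, ω₈⁷],[ω₈⁵, ω₈]] ∈ SL₂(ℂ)`. -/
def μ : SL2 :=
  ⟨(Real.sqrt 2 : ℂ)⁻¹ • !![ω 8 ^ 7, ω 8 ^ 7; ω 8 ^ 5, ω 8], by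
    have h2 : ((Real.sqrt 2 : ℂ))^2 = 2 := by
      rw [← Complex.ofReal_pow, Real.sq_sqrt (by norm_num : (2:ℝ) ≥ 0)]
      norm_num
    have hdet : Matrix.det !![ω 8 ^ 7, ω 8 ^ 7; ω 8 ^ 5, ω 8] = 2 := by
      rw [Matrix.det_fin_two_of]
      linear_combination 2 * ω_eight_pow_eight - ω 8 ^ 8 * ω_eight_pow_four
    have hs : (Real.sqrt 2 : ℂ) ≠ 0 := by
      simpa using Real.sqrt_ne_zero'.mpr (by norm_num : (0:ℝ) < 2)
    rw [Matrix.det_smul, hdet]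
    rw [show (Fintype.card (Fin 2)) = 2 from rfl]
    field_simp
    exact h2.symm⟩

lemma ofReal_sqrt_two_sq : (Real.sqrt 2 : ℂ) ^ 2 = 2 := by
  rw [← ofReal_pow, Real.sq_sqrt (by norm_num : (2 : ℝ) ≥ 0)]
  norm_num

lemma ω_four : ω 4 = I := by
  rw [ω, show 2 * (Real.pi : ℂ) * I / ((4 : ℕ) : ℂ) = Real.pi / 2 * I by push_cast; ring,
    exp_pi_div_two_mul_I]

lemma ω_eight_mul_sqrt_two : ω 8 * (Real.sqrt 2 : ℂ) = 1 + I := by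
  have h2 := ofReal_sqrt_two_sq
  rw [ω, show 2 * (Real.pi : ℂ) * I / ((8 : ℕ) : ℂ) = ((Real.pi / 4 : ℝ) : ℂ) * I by
      push_cast; ring, exp_mul_I, ← ofReal_cos, ← ofReal_sin, Real.cos_pi_div_four,
    Real.sin_pi_div_four]
  push_cast
  linear_combination (1 + I) / 2 * h2

/-- The matrix of `σ 4` over the Gaussian integers. -/
def gaussianSigma : Matrix (Fin 2) (Fin 2) GaussianInt := !![⟨0, 1⟩, 0; 0, ⟨0, -1⟩]

/-- The matrix of `τ` over the Gaussian integers. -/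
def gaussianTau : Matrix (Fin 2) (Fin 2) GaussianInt := !![0, 1; -1, 0]

/-- The matrix of `2μ` over the Gaussian integers. -/
def gaussianTwoMu : Matrix (Fin 2) (Fin 2) GaussianInt :=
  !![⟨1, -1⟩, ⟨1, -1⟩; ⟨-1, -1⟩, ⟨1, 1⟩]

/-- Entrywise inclusion of the Gaussian integers in `ℂ`. -/
def gaussianMatrixHom : Matrix (Fin 2) (Fin 2) GaussianInt →+* Matrix (Fin 2) (Fin 2) ℂ :=
  GaussianInt.toComplex.mapMatrix

lemma gaussianMatrixHom_injective : Function.Injective gaussianMatrixHom := by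
  intro A B h
  ext1 i j
  exact GaussianInt.toComplex_inj.mp (congrFun (congrFun h i) j)

lemma gaussianMatrixHom_sigma : gaussianMatrixHom gaussianSigma = (σ 4 : SL2).1 := by
  ext i j
  fin_cases i <;> fin_cases j <;>
    simp [gaussianMatrixHom, gaussianSigma, σ, ω_four, GaussianInt.toComplex_def]

lemma gaussianMatrixHom_tau : gaussianMatrixHom gaussianTau = τ.1 := by
  ext i j
  fin_cases i <;> fin_cases j <;> simp [gaussianMatrixHom, gaussianTau, τ]

lemma gaussianMatrixHom_twoMu : gaussianMatrixHom gaussianTwoMu = (2 : ℂ) • μ.1 := by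
  have h2 := ofReal_sqrt_two_sq
  have hs : (Real.sqrt 2 : ℂ) ≠ 0 := by
    rintro h
    simp [h] at h2
  have hinv : (Real.sqrt 2 : ℂ)⁻¹ = Real.sqrt 2 / 2 := by
    field_simp
    exact h2.symm
  have h1 : (Real.sqrt 2 : ℂ)⁻¹ * ω 8 = (1 + I) / 2 := by
    rw [hinv, ← ω_eight_mul_sqrt_two]
    ring
  have hsq : ω 8 ^ 2 = I := by
    linear_combination (ω 8 * Real.sqrt 2 + 1 + I) / 2 * ω_eight_mul_sqrt_two
      - ω 8 ^ 2 / 2 * h2 + I_sq / 2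
  have h5 : (Real.sqrt 2 : ℂ)⁻¹ * ω 8 ^ 5 = (-1 - I) / 2 := by
    linear_combination ω 8 ^ 4 * h1 + (1 + I) / 2 * ω_eight_pow_four
  have h7 : (Real.sqrt 2 : ℂ)⁻¹ * ω 8 ^ 7 = (1 - I) / 2 := by
    linear_combination ω 8 ^ 2 * h5 + (-1 - I) / 2 * hsq - I_sq / 2
  ext i j
  fin_cases i <;> fin_cases j <;>
    simp [gaussianMatrixHom, gaussianTwoMu, μ, h1, h5, h7, GaussianInt.toComplex_def] <;> ring

/-- The words `σ₄ᵃ τᵇ μᶜ` with `a < 4`, `b < 2`, `c < 3`. -/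
def tetrahedralWord (x : Fin 4 × Fin 2 × Fin 3) : SL2 :=
  σ 4 ^ x.1.1 * τ ^ x.2.1.1 * μ ^ x.2.2.1

/-- The word `σ₄ᵃ τᵇ (2μ)ᶜ` over the Gaussian integers. -/
def gaussianWord (x : Fin 4 × Fin 2 × Fin 3) : Matrix (Fin 2) (Fin 2) GaussianInt :=
  gaussianSigma ^ x.1.1 * gaussianTau ^ x.2.1.1 * gaussianTwoMu ^ x.2.2.1

lemma gaussianMatrixHom_word (x : Fin 4 × Fin 2 × Fin 3) :
    gaussianMatrixHom (gaussianWord x) = (2 : ℂ) ^ x.2.2.1 • (tetrahedralWord x).1 := by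
  have h : (tetrahedralWord x).1 = (σ 4).1 ^ x.1.1 * τ.1 ^ x.2.1.1 * μ.1 ^ x.2.2.1 := rfl
  rw [h, gaussianWord, map_mul, map_mul, map_pow, map_pow, map_pow, gaussianMatrixHom_sigma,
    gaussianMatrixHom_tau, gaussianMatrixHom_twoMu, smul_pow, mul_smul_comm]

lemma gaussianMatrixHom_two_pow_smul (n : ℕ) (A : Matrix (Fin 2) (Fin 2) GaussianInt) :
    gaussianMatrixHom ((2 : GaussianInt) ^ n • A) = (2 : ℂ) ^ n • gaussianMatrixHom A := by
  ext i j
  simp [gaussianMatrixHom, map_ofNat GaussianInt.toComplex 2]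

lemma tetrahedralWord_injective : Function.Injective tetrahedralWord := by
  have key : ∀ x y : Fin 4 × Fin 2 × Fin 3,
      (2 : GaussianInt) ^ y.2.2.1 • gaussianWord x = (2 : GaussianInt) ^ x.2.2.1 • gaussianWord y →
        x = y := by
    decide +kernel
  intro x y h
  apply key
  apply gaussianMatrixHom_injective
  rw [gaussianMatrixHom_two_pow_smul, gaussianMatrixHom_two_pow_smul, gaussianMatrixHom_word,
    gaussianMatrixHom_word, h, smul_comm]

/-- If `2ⁿ g` is the Gaussian matrix `A`, and left multiplication by `A` preserves the Gaussian words
up to scaling, then left multiplication by `g` preserves the words in `SL₂(ℂ)`. -/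
lemma mul_tetrahedralWord_mem {g : SL2} {A : Matrix (Fin 2) (Fin 2) GaussianInt} {n : ℕ}
    (hg : gaussianMatrixHom A = (2 : ℂ) ^ n • g.1)
    (hA : ∀ x, ∃ y : Fin 4 × Fin 2 × Fin 3,
      (2 : GaussianInt) ^ y.2.2.1 • (A * gaussianWord x) =
        (2 : GaussianInt) ^ (n + x.2.2.1) • gaussianWord y)
    {h : SL2} (hh : h ∈ Set.range tetrahedralWord) : g * h ∈ Set.range tetrahedralWord := by
  obtain ⟨x, rfl⟩ := hh
  obtain ⟨y, hy⟩ := hA x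
  refine ⟨y, Subtype.ext ?_⟩
  replace hy := congrArg gaussianMatrixHom hy
  rw [gaussianMatrixHom_two_pow_smul, gaussianMatrixHom_two_pow_smul, map_mul, hg,
    gaussianMatrixHom_word, gaussianMatrixHom_word, smul_mul_smul_comm, ← pow_add,
    smul_smul, smul_smul, ← pow_add, ← pow_add, add_comm] at hy
  exact (smul_right_injective _ (pow_ne_zero _ two_ne_zero) hy).symm

/-- The subgroup generated by `s` lies in every finite set that contains `1` and is stable under left
multiplication by `s`. -/
lemma closure_subset_of_finite_of_mul_mem {G : Type*} [Group G] {s t : Set G} (ht : t.Finite)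
    (one_mem : 1 ∈ t) (mul_mem : ∀ g ∈ s, ∀ h ∈ t, g * h ∈ t) :
    (Subgroup.closure s : Set G) ⊆ t := by
  intro g hg
  induction hg using Subgroup.closure_induction_left with
  | one => exact one_mem
  | mul_left g hg h _ ih => exact mul_mem g hg h ih
  | inv_mul_cancel g hg h _ ih =>
    obtain ⟨k, hk, hkh⟩ := ((ht.injOn_iff_bijOn_of_mapsTo (mul_mem g hg)).mp
      (mul_right_injective g).injOn).surjOn ih
    simpa [← hkh] using hk

lemma closure_eq_range_tetrahedralWord :
    (Subgroup.closure ({σ 4, τ, μ} : Set SL2) : Set SL2) = Set.range tetrahedralWord := by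
  apply Set.Subset.antisymm
  · refine closure_subset_of_finite_of_mul_mem (Set.finite_range _) ⟨(0, 0, 0), ?_⟩ ?_
    · simp [tetrahedralWord]
    · rintro g (rfl | rfl | rfl) h hh
      · exact mul_tetrahedralWord_mem (n := 0)
          (by rw [gaussianMatrixHom_sigma, pow_zero, one_smul]) (by decide +kernel) hh
      · exact mul_tetrahedralWord_mem (n := 0)
          (by rw [gaussianMatrixHom_tau, pow_zero, one_smul]) (by decide +kernel) hh
      · exact mul_tetrahedralWord_mem (n := 1)
          (by rw [gaussianMatrixHom_twoMu, pow_one]) (by decide +kernel) hh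
  · rintro _ ⟨x, rfl⟩
    have mem {g : SL2} (hg : g ∈ ({σ 4, τ, μ} : Set SL2)) := Subgroup.subset_closure hg
    exact mul_mem (mul_mem (pow_mem (mem (by simp)) _) (pow_mem (mem (by simp)) _))
      (pow_mem (mem (by simp)) _)

/-- The binary tetrahedral group `⟨σ₄, τ, μ⟩ ≤ SL₂(ℂ)` is a finite group of order 24. -/
theorem binary_tetrahedral_finite_card :
    Finite (Subgroup.closure ({σ 4, τ, μ} : Set SL2)) ∧
    Nat.card (Subgroup.closure ({σ 4, τ, μ} : Set SL2)) = 24 := by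
  rw [← SetLike.coe_sort_coe, closure_eq_range_tetrahedralWord]
  refine ⟨inferInstance, ?_⟩
  rw [Nat.card_range_of_injective tetrahedralWord_injective]
  simp
end
end

section
/- For every integer r ≥ 4, a polynomial P ∈ ℂ[Z₁, Z₂] is invariant under the binary dihedral group ⟨σ_{2r-4}, τ⟩ (i.e. P(g·(z₁,z₂)) = P(z₁,z₂) for all g in the group and all (z₁,z₂) ∈ ℂ²) if and only if P lies in the ℂ-subalgebra of ℂ[Z₁, Z₂] generated by X = Z₁²Z₂², Y = (1/2)(Z₁^{2r-4} + Z₂^{2r-4}), and Z = (1/2)Z₁Z₂(Z₁^{2r-4} − Z₂^{2r-4}). -/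
noncomputable section

open Complex Matrix MvPolynomial

/-- The basic invariant `X = Z₁²Z₂²` of the binary dihedral group. -/
def XD : MvPolynomial (Fin 2) ℂ :=
  (MvPolynomial.X 0) ^ 2 * (MvPolynomial.X 1) ^ 2

/-- The basic invariant `Y = (1/2)(Z₁^{2r−4} + Z₂^{2r−4})` of the binary dihedral group. -/
def YD (r : ℕ) : MvPolynomial (Fin 2) ℂ :=
  MvPolynomial.C (1/2 : ℂ) * ((MvPolynomial.X 0) ^ (2*r-4) + (MvPolynomial.X 1) ^ (2*r-4))

/-- The basic invariant `Z = (1/2)Z₁Z₂(Z₁^{2r−4} − Z₂^{2r−4})` of the binary dihedral group. -/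
def ZD (r : ℕ) : MvPolynomial (Fin 2) ℂ :=
  MvPolynomial.C (1/2 : ℂ) *
    (MvPolynomial.X 0 * MvPolynomial.X 1 *
      ((MvPolynomial.X 0) ^ (2*r-4) - (MvPolynomial.X 1) ^ (2*r-4)))

/-- A polynomial function invariant under a set of matrices in `SL₂(ℂ)` is invariant under the
subgroup they generate. -/
theorem eval_mulVec_eq_of_mem_closure {s : Set SL2} {P : MvPolynomial (Fin 2) ℂ}
    (h : ∀ g ∈ s, ∀ z : Fin 2 → ℂ,
      MvPolynomial.eval ((g : Matrix (Fin 2) (Fin 2) ℂ) *ᵥ z) P = MvPolynomial.eval z P)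
    {g : SL2} (hg : g ∈ Subgroup.closure s) (z : Fin 2 → ℂ) :
    MvPolynomial.eval ((g : Matrix (Fin 2) (Fin 2) ℂ) *ᵥ z) P = MvPolynomial.eval z P := by
  induction hg using Subgroup.closure_induction generalizing z with
  | mem g hg => exact h g hg z
  | one => simp
  | mul a b _ _ iha ihb =>
    rw [Matrix.SpecialLinearGroup.coe_mul, ← Matrix.mulVec_mulVec, iha, ihb]
  | inv a _ ih =>
    rw [← ih, Matrix.mulVec_mulVec, ← Matrix.SpecialLinearGroup.coe_mul]
    simp

theorem σ_mulVec (N : ℕ) (z : Fin 2 → ℂ) :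
    ((σ N : SL2) : Matrix (Fin 2) (Fin 2) ℂ) *ᵥ z = ![ω N * z 0, (ω N)⁻¹ * z 1] := by
  ext i
  fin_cases i <;> simp [σ, Matrix.mulVec, dotProduct, Fin.sum_univ_two]

theorem τ_mulVec (z : Fin 2 → ℂ) :
    ((τ : SL2) : Matrix (Fin 2) (Fin 2) ℂ) *ᵥ z = ![z 1, -z 0] := by
  ext i
  fin_cases i <;> simp [τ, Matrix.mulVec, dotProduct, Fin.sum_univ_two]

theorem isPrimitiveRoot_ω {N : ℕ} (hN : N ≠ 0) : IsPrimitiveRoot (ω N) N :=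
  Complex.isPrimitiveRoot_exp N hN

/-- Every element of the algebra generated by `X`, `Y`, `Z` is invariant. -/
theorem eval_mulVec_eq_of_mem_adjoin {r : ℕ} (hr : 4 ≤ r) {P : MvPolynomial (Fin 2) ℂ}
    (hP : P ∈ Algebra.adjoin ℂ ({XD, YD r, ZD r} : Set (MvPolynomial (Fin 2) ℂ)))
    {g : SL2} (hg : g ∈ ({σ (2*r-4), τ} : Set SL2)) (z : Fin 2 → ℂ) :
    MvPolynomial.eval ((g : Matrix (Fin 2) (Fin 2) ℂ) *ᵥ z) P = MvPolynomial.eval z P := by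
  have hω : ω (2*r-4) ≠ 0 := Complex.exp_ne_zero _
  have hpow : ω (2*r-4) ^ (2*r-4) = 1 := (isPrimitiveRoot_ω (by omega)).pow_eq_one
  have heven : Even (2*r-4) := ⟨r - 2, by omega⟩
  induction hP using Algebra.adjoin_induction with
  | mem p hp =>
    rcases hg with rfl | rfl <;> rcases hp with rfl | rfl | rfl
    · simp only [σ_mulVec, XD, map_mul, map_pow, eval_X, Matrix.cons_val_zero,
        Matrix.cons_val_one]
      field_simp
    · simp only [σ_mulVec, YD, map_mul, map_add, map_pow, eval_X, eval_C, Matrix.cons_val_zero,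
        Matrix.cons_val_one, mul_pow, inv_pow, hpow]
      simp
    · simp only [σ_mulVec, ZD, map_mul, map_sub, map_pow, eval_X, eval_C, Matrix.cons_val_zero,
        Matrix.cons_val_one, mul_pow, inv_pow, hpow]
      field_simp
    · simp only [τ_mulVec, XD, map_mul, map_pow, eval_X, Matrix.cons_val_zero,
        Matrix.cons_val_one]
      ring
    · simp only [τ_mulVec, YD, map_mul, map_add, map_pow, eval_X, eval_C, Matrix.cons_val_zero,
        Matrix.cons_val_one, heven.neg_pow]
      ring
    · simp only [τ_mulVec, ZD, map_mul, map_sub, map_pow, eval_X, eval_C, Matrix.cons_val_zero,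
        Matrix.cons_val_one, heven.neg_pow]
      ring
  | algebraMap c => simp [MvPolynomial.algebraMap_eq]
  | add p q _ _ hp hq => simp only [map_add, hp, hq]
  | mul p q _ _ hp hq => simp only [map_mul, hp, hq]

/-- If `u + v` and `u * v` lie in a subalgebra together with `w * (u ^ k + ε * v ^ k)` for
`k = 0, 1`, then so does `w * (u ^ k + ε * v ^ k)` for every `k`. -/
theorem mul_pow_add_mul_pow_mem {R A : Type*} [CommRing R] [CommRing A] [Algebra R A]
    {S : Subalgebra R A} {u v w ε : A} (hadd : u + v ∈ S) (hmul : u * v ∈ S)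
    (h0 : w * (1 + ε) ∈ S) (h1 : w * (u + ε * v) ∈ S) (k : ℕ) :
    w * (u ^ k + ε * v ^ k) ∈ S := by
  induction k using Nat.twoStepInduction with
  | zero => simpa using h0
  | one => simpa using h1
  | more k ih0 ih1 =>
    have h := S.sub_mem (S.mul_mem hadd ih1) (S.mul_mem hmul ih0)
    convert h using 1
    ring

/-- The symmetrization of a `σ`-invariant monomial lies in the algebra generated by
`X`, `Y`, `Z`. -/
theorem symmetrized_mem_adjoin_of_le {r : ℕ} (hr : 4 ≤ r) {a b : ℕ} (hba : b ≤ a)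
    (h : a ≡ b [MOD 2*r-4]) :
    (X 0 ^ a * X 1 ^ b + (-1) ^ b * (X 0 ^ b * X 1 ^ a) : MvPolynomial (Fin 2) ℂ) ∈
      Algebra.adjoin ℂ ({XD, YD r, ZD r} : Set (MvPolynomial (Fin 2) ℂ)) := by
  set S := Algebra.adjoin ℂ ({XD, YD r, ZD r} : Set (MvPolynomial (Fin 2) ℂ))
  have hX : XD ∈ S := Algebra.subset_adjoin (by simp)
  have hY : YD r ∈ S := Algebra.subset_adjoin (by simp)
  have hZ : ZD r ∈ S := Algebra.subset_adjoin (by simp)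
  have h2 : (2 : MvPolynomial (Fin 2) ℂ) * C (1/2 : ℂ) = 1 := by
    rw [show (2 : MvPolynomial (Fin 2) ℂ) = C 2 from (map_ofNat C 2).symm, ← C_mul]
    norm_num
  have h2S : (2 : MvPolynomial (Fin 2) ℂ) ∈ S := ofNat_mem S 2
  have hadd : (X 0 ^ (2*r-4) + X 1 ^ (2*r-4) : MvPolynomial (Fin 2) ℂ) ∈ S := by
    convert S.mul_mem h2S hY using 1
    rw [YD, ← mul_assoc, h2, one_mul]
  have hsub : (X 0 * X 1 * (X 0 ^ (2*r-4) - X 1 ^ (2*r-4)) : MvPolynomial (Fin 2) ℂ) ∈ S := by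
    convert S.mul_mem h2S hZ using 1
    rw [ZD, ← mul_assoc 2, h2, one_mul]
  have hmul : (X 0 ^ (2*r-4) * X 1 ^ (2*r-4) : MvPolynomial (Fin 2) ℂ) ∈ S := by
    convert S.pow_mem hX (r - 2) using 1
    rw [XD, mul_pow, ← pow_mul, ← pow_mul, show 2 * (r - 2) = 2 * r - 4 by omega]
  obtain ⟨k, hk⟩ := (Nat.modEq_iff_dvd' hba).mp h.symm
  obtain rfl : a = b + (2*r-4) * k := by omega
  rcases Nat.even_or_odd' b with ⟨c, rfl | rfl⟩
  · have hpow := mul_pow_add_mul_pow_mem (w := 1) (ε := 1) hadd hmul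
      (S.mul_mem S.one_mem (S.add_mem S.one_mem S.one_mem)) (by simpa using hadd) k
    convert S.mul_mem (S.pow_mem hX c) hpow using 1
    rw [XD, (even_two_mul c).neg_one_pow]
    ring
  · have hpow := mul_pow_add_mul_pow_mem (w := X 0 * X 1) (ε := -1) hadd hmul
      (by simp) (by simpa [sub_eq_add_neg] using hsub) k
    convert S.mul_mem (S.pow_mem hX c) hpow using 1
    rw [XD, (odd_two_mul_add_one c).neg_one_pow]
    ring

theorem symmetrized_mem_adjoin {r : ℕ} (hr : 4 ≤ r) {a b : ℕ} (h : a ≡ b [MOD 2*r-4]) :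
    (X 0 ^ a * X 1 ^ b + (-1) ^ b * (X 0 ^ b * X 1 ^ a) : MvPolynomial (Fin 2) ℂ) ∈
      Algebra.adjoin ℂ ({XD, YD r, ZD r} : Set (MvPolynomial (Fin 2) ℂ)) := by
  rcases le_total b a with hba | hab
  · exact symmetrized_mem_adjoin_of_le hr hba h
  · have hpar : a ≡ b [MOD 2] := h.of_dvd ⟨r - 2, by omega⟩
    have hsign : ((-1) ^ a : MvPolynomial (Fin 2) ℂ) = (-1) ^ b :=
      neg_one_pow_congr (by rw [Nat.even_iff, Nat.even_iff, hpar])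
    have hmem := Subalgebra.mul_mem _ (Subalgebra.pow_mem _
      (Subalgebra.neg_mem _ (Subalgebra.one_mem _)) b)
      (symmetrized_mem_adjoin_of_le hr hab h.symm)
    convert hmem using 1
    have hsq : ((-1) ^ b * (-1) ^ b : MvPolynomial (Fin 2) ℂ) = 1 := by
      rw [← mul_pow]; simp
    rw [hsign]
    linear_combination (-(X 0 ^ a * X 1 ^ b) : MvPolynomial (Fin 2) ℂ) * hsq

theorem monomial_fin_two (d : Fin 2 →₀ ℕ) (c : ℂ) :
    monomial d c = C c * (X 0 ^ d 0 * X 1 ^ d 1) := by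
  rw [monomial_eq, Finsupp.prod_fintype _ _ (by simp), Fin.prod_univ_two]

/-- A polynomial is fixed by a substitution as soon as the associated polynomial functions
agree. -/
theorem aeval_eq_self_of_eval_eq {ι R : Type*} [CommRing R] [IsDomain R] [Infinite R]
    {f : ι → MvPolynomial ι R} {P : MvPolynomial ι R}
    (h : ∀ z : ι → R, MvPolynomial.eval (fun i => MvPolynomial.eval z (f i)) P =
      MvPolynomial.eval z P) : aeval f P = P := by
  refine MvPolynomial.funext fun z => ?_
  rw [← h z, ← coe_aeval_eq_eval, ← coe_aeval_eq_eval]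
  exact comp_aeval_apply (φ := aeval z) (f := f) P

/-- Rescaling the two variables rescales the coefficients. -/
theorem coeff_aeval_scale (s t : ℂ) (d : Fin 2 →₀ ℕ) (P : MvPolynomial (Fin 2) ℂ) :
    coeff d (aeval ![C s * X 0, C t * X 1] P : MvPolynomial (Fin 2) ℂ) =
      s ^ d 0 * t ^ d 1 * coeff d P := by
  induction P using MvPolynomial.induction_on' with
  | monomial e c =>
    have : (aeval ![C s * X 0, C t * X 1] (monomial e c) : MvPolynomial (Fin 2) ℂ) =
        monomial e (s ^ e 0 * t ^ e 1 * c) := by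
      simp only [monomial_fin_two, map_mul, map_pow, aeval_X, aeval_C, algebraMap_eq,
        Matrix.cons_val_zero, Matrix.cons_val_one]
      ring
    rw [this, coeff_monomial, coeff_monomial]
    split_ifs with hed
    · rw [hed]
    · simp
  | add p q hp hq => rw [map_add, coeff_add, coeff_add, hp, hq, mul_add]

/-- The exponents occurring in a `σ`-invariant polynomial are congruent. -/
theorem modEq_of_mem_support {N : ℕ} (hN : N ≠ 0) {P : MvPolynomial (Fin 2) ℂ}
    (h : ∀ z : Fin 2 → ℂ, MvPolynomial.eval (((σ N : SL2) : Matrix (Fin 2) (Fin 2) ℂ) *ᵥ z) P =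
      MvPolynomial.eval z P) {d : Fin 2 →₀ ℕ} (hd : d ∈ P.support) : d 0 ≡ d 1 [MOD N] := by
  have hfix : (aeval ![C (ω N) * X 0, C (ω N)⁻¹ * X 1] P : MvPolynomial (Fin 2) ℂ) = P := by
    refine aeval_eq_self_of_eval_eq fun z => ?_
    rw [← h z, σ_mulVec]
    congr 2
    ext i
    fin_cases i <;> simp
  have hcoeff := coeff_aeval_scale (ω N) (ω N)⁻¹ d P
  rw [hfix] at hcoeff
  have hω : ω N ≠ 0 := Complex.exp_ne_zero _
  have hone := (eq_comm.trans (mul_eq_right₀ (mem_support_iff.mp hd))).mp hcoeff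
  rw [inv_pow, mul_inv_eq_one₀ (pow_ne_zero _ hω),
    ((isPrimitiveRoot_ω hN).isOfFinOrder hN).pow_eq_pow_iff_modEq, ← (isPrimitiveRoot_ω hN).eq_orderOf] at hone
  exact hone

/-- For every `r ≥ 4`, a polynomial `P ∈ ℂ[Z₁,Z₂]` is invariant under the binary dihedral
group `⟨σ_{2r−4}, τ⟩` iff it lies in the `ℂ`-subalgebra generated by `X`, `Y`, `Z`. -/
theorem D_invariant_iff_mem_adjoin (r : ℕ) (hr : 4 ≤ r) (P : MvPolynomial (Fin 2) ℂ) :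
    (∀ g ∈ Subgroup.closure ({σ (2*r-4), τ} : Set SL2), ∀ z : Fin 2 → ℂ,
        MvPolynomial.eval (Matrix.mulVec (↑g : Matrix (Fin 2) (Fin 2) ℂ) z) P =
          MvPolynomial.eval z P) ↔
      P ∈ Algebra.adjoin ℂ ({XD, YD r, ZD r} : Set (MvPolynomial (Fin 2) ℂ)) := by
  refine ⟨fun h => ?_, fun hP g hg z =>
    eval_mulVec_eq_of_mem_closure (fun _ => eval_mulVec_eq_of_mem_adjoin hr hP) hg z⟩
  have hσ := h (σ (2*r-4)) (Subgroup.subset_closure (by simp))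
  have hτ := h τ (Subgroup.subset_closure (by simp))
  have hfix : (aeval ![X 1, -X 0] P : MvPolynomial (Fin 2) ℂ) = P := by
    refine aeval_eq_self_of_eval_eq fun z => ?_
    rw [← hτ z, τ_mulVec]
    congr 2
    ext i
    fin_cases i <;> simp
  have hhalf : P = (1/2 : ℂ) • (P + aeval ![X 1, -X 0] P) := by
    rw [hfix, ← two_smul ℂ P, smul_smul]
    norm_num
  have hsum : P + aeval ![X 1, -X 0] P = ∑ d ∈ P.support, coeff d P •
      (X 0 ^ d 0 * X 1 ^ d 1 + (-1) ^ d 1 * (X 0 ^ d 1 * X 1 ^ d 0)) := by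
    conv_lhs => rw [P.as_sum]
    rw [map_sum, ← Finset.sum_add_distrib]
    refine Finset.sum_congr rfl fun d _ => ?_
    simp only [monomial_fin_two, map_mul, map_pow, aeval_X, aeval_C, algebraMap_eq,
      Matrix.cons_val_zero, Matrix.cons_val_one, smul_eq_C_mul,
      neg_pow (X 0 : MvPolynomial (Fin 2) ℂ)]
    ring
  rw [hhalf, hsum]
  exact Subalgebra.smul_mem _ (Subalgebra.sum_mem _ fun d hd => Subalgebra.smul_mem _
    (symmetrized_mem_adjoin hr (modEq_of_mem_support (by omega) hσ hd)) _) _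
end
end

section
/- Let F₁₂(Z₁,Z₂) = Z₁Z₂(Z₁¹⁰ + 11Z₁⁵Z₂⁵ − Z₂¹⁰), let F₂₀ be the determinant of the Hessian matrix of F₁₂, and let J be the determinant of the Jacobian matrix of (F₁₂, F₂₀). Then the Klein icosahedral syzygy ((1/2420)·J)² + ((1/121)·F₂₀)³ = 1728·F₁₂⁵ holds in ℂ[Z₁, Z₂]; equivalently, the invariants X, Y, Z of the binary icosahedral group with X⁵ = −1728·F₁₂⁵, Y = F₂₀/121, Z = J/2420 satisfy X⁵ + Y³ + Z² = 0. -/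
noncomputable section

open MvPolynomial

/-- `F₁₂ = Z₁Z₂(Z₁¹⁰ + 11Z₁⁵Z₂⁵ − Z₂¹⁰)`. -/
def F12 : MvPolynomial (Fin 2) ℂ :=
  MvPolynomial.X 0 * MvPolynomial.X 1 *
    ((MvPolynomial.X 0) ^ 10 + 11 * (MvPolynomial.X 0) ^ 5 * (MvPolynomial.X 1) ^ 5
      - (MvPolynomial.X 1) ^ 10)

/-- `F₂₀` is the determinant of the Hessian matrix of `F₁₂`. -/
def F20 : MvPolynomial (Fin 2) ℂ :=
  MvPolynomial.pderiv 0 (MvPolynomial.pderiv 0 F12) *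
      MvPolynomial.pderiv 1 (MvPolynomial.pderiv 1 F12) -
    MvPolynomial.pderiv 0 (MvPolynomial.pderiv 1 F12) *
      MvPolynomial.pderiv 1 (MvPolynomial.pderiv 0 F12)

/-- `J` is the determinant of the Jacobian matrix of `(F₁₂, F₂₀)`. -/
def Jdet : MvPolynomial (Fin 2) ℂ :=
  MvPolynomial.pderiv 0 F12 * MvPolynomial.pderiv 1 F20 -
    MvPolynomial.pderiv 1 F12 * MvPolynomial.pderiv 0 F20

theorem pderiv_ofNat {σ R : Type*} [CommSemiring R] (i : σ) (n : ℕ) [n.AtLeastTwo] :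
    pderiv i (ofNat(n) : MvPolynomial σ R) = 0 := by
  rw [← map_ofNat C n, pderiv_C]

theorem pderiv_zero_F12 : pderiv 0 F12 =
    11 * X 0 ^ 10 * X 1 + 66 * X 0 ^ 5 * X 1 ^ 6 - X 1 ^ 11 := by
  simp only [F12, map_add, map_sub, Derivation.leibniz, Derivation.leibniz_pow, pderiv_X_self,
    pderiv_X_of_ne one_ne_zero, pderiv_ofNat, smul_eq_mul, nsmul_eq_mul]
  push_cast
  ring

theorem pderiv_one_F12 : pderiv 1 F12 =
    X 0 ^ 11 + 66 * X 0 ^ 6 * X 1 ^ 5 - 11 * X 0 * X 1 ^ 10 := by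
  simp only [F12, map_add, map_sub, Derivation.leibniz, Derivation.leibniz_pow, pderiv_X_self,
    pderiv_X_of_ne zero_ne_one, pderiv_ofNat, smul_eq_mul, nsmul_eq_mul]
  push_cast
  ring

theorem F20_eq : F20 = 121 * (-(X 0 ^ 20 + X 1 ^ 20) +
    228 * (X 0 ^ 15 * X 1 ^ 5 - X 0 ^ 5 * X 1 ^ 15) - 494 * X 0 ^ 10 * X 1 ^ 10) := by
  simp only [F20, pderiv_zero_F12, pderiv_one_F12, map_add, map_sub, Derivation.leibniz,
    Derivation.leibniz_pow, pderiv_X_self, pderiv_X_of_ne zero_ne_one,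
    pderiv_X_of_ne one_ne_zero, pderiv_ofNat, smul_eq_mul, nsmul_eq_mul]
  push_cast
  ring

theorem Jdet_eq : Jdet = 2420 * (X 0 ^ 30 + X 1 ^ 30 +
    522 * (X 0 ^ 25 * X 1 ^ 5 - X 0 ^ 5 * X 1 ^ 25) -
    10005 * (X 0 ^ 20 * X 1 ^ 10 + X 0 ^ 10 * X 1 ^ 20)) := by
  simp only [Jdet, pderiv_zero_F12, pderiv_one_F12, F20_eq, map_add, map_sub, map_neg,
    Derivation.leibniz, Derivation.leibniz_pow, pderiv_X_self, pderiv_X_of_ne zero_ne_one,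
    pderiv_X_of_ne one_ne_zero, pderiv_ofNat, smul_eq_mul, nsmul_eq_mul]
  push_cast
  ring

/-- The Klein icosahedral syzygy `((1/2420)·J)² + ((1/121)·F₂₀)³ = 1728·F₁₂⁵`
in `ℂ[Z₁,Z₂]`. -/
theorem E8_syzygy :
    (MvPolynomial.C (1/2420 : ℂ) * Jdet) ^ 2 + (MvPolynomial.C (1/121 : ℂ) * F20) ^ 3 =
      MvPolynomial.C (1728 : ℂ) * F12 ^ 5 := by
  have hJ : (C (1 / 2420 : ℂ) : MvPolynomial (Fin 2) ℂ) * 2420 = 1 := by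
    rw [← map_ofNat C 2420, ← C_mul]
    norm_num
  have hF : (C (1 / 121 : ℂ) : MvPolynomial (Fin 2) ℂ) * 121 = 1 := by
    rw [← map_ofNat C 121, ← C_mul]
    norm_num
  rw [Jdet_eq, F20_eq, ← mul_assoc, ← mul_assoc, hJ, hF, F12, map_ofNat]
  ring
end
end
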